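/- arXiv:1706.06249 — 2 statements merged into one kernel-verified Lean document; each statement's English description precedes it below -/
import Mathlib

section
/- Let $k>0$, $T>0$, $n>0$, and let $b\in C^1((0,T])$ satisfy $\lim_{t\to 0^+}b(t)=0$, $b'(t)>0$ for all $t\in(0,T]$, and $\frac{b'^2}{b}\in L^1([0,T])$. Define $\beta(t)=1-\frac{2k}{b(t)e^{2kt}}\int_0^t b(s)e^{2ks}\,ds$ and $\psi(t)=\frac{n}{8b(t)}\int_0^t\frac{b'(s)^2}{b(s)\beta(s)}\,ds$. Then $\psi$ solves the linear ODE $\psi'(t)+\frac{2k\beta(t)+\beta'(t)}{1-\beta(t)}\,\psi(t)-\frac{n\,(2k\beta(t)+\beta'(t))^2}{8\beta(t)(1-\beta(t))^2}=0$ for all $t\in(0,T]$. -/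
open Real Set Filter MeasureTheory

theorem hasDerivWithinAt_integral_of_continuousOn_Ioc {f : ℝ → ℝ} {T t : ℝ}
    (hf : ContinuousOn f (Ioc 0 T)) (hfi : IntegrableOn f (Ioc 0 T)) (ht : t ∈ Ioc 0 T) :
    HasDerivWithinAt (fun u => ∫ s in (0:ℝ)..u, f s) (f t) (Ioc 0 T) t := by
  obtain ⟨ht0, htT⟩ := ht
  have hsub : Icc (t / 2) T ⊆ Ioc 0 T := fun x hx => ⟨by linarith [hx.1], hx.2⟩
  have hmem : Icc (t / 2) T ∈ nhdsWithin t (Ioc 0 T) := by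
    filter_upwards [self_mem_nhdsWithin,
      mem_nhdsWithin_of_mem_nhds (Ici_mem_nhds (half_lt_self ht0))] with x hx hx'
    exact ⟨hx', hx.2⟩
  have htm : t ∈ Icc (t / 2) T := ⟨by linarith, htT⟩
  have : Fact (t ∈ Icc (t / 2) T) := ⟨htm⟩
  have hii : IntervalIntegrable f volume 0 t :=
    (intervalIntegrable_iff_integrableOn_Ioc_of_le ht0.le).2
      (hfi.mono_set (Ioc_subset_Ioc_right htT))
  have hmeas : StronglyMeasurableAtFilter f (nhdsWithin t (Icc (t / 2) T)) volume :=
    (hf.mono hsub).stronglyMeasurableAtFilter_nhdsWithin measurableSet_Icc t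
  exact (intervalIntegral.integral_hasDerivWithinAt_right (t := Icc (t / 2) T) hii hmeas
    ((hf.mono hsub) t htm)).mono_of_mem_nhdsWithin hmem

theorem strictMonoOn_Ioc_of_derivWithin_pos {b : ℝ → ℝ} {T : ℝ}
    (hb : ContinuousOn b (Ioc 0 T)) (hb' : ∀ t ∈ Ioc 0 T, 0 < derivWithin b (Ioc 0 T) t) :
    StrictMonoOn b (Ioc 0 T) := by
  refine strictMonoOn_of_deriv_pos (convex_Ioc 0 T) hb fun x hx => ?_
  rw [interior_Ioc] at hx
  rw [← derivWithin_of_mem_nhds (Ioc_mem_nhds hx.1 hx.2)]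
  exact hb' x (Ioo_subset_Ioc_self hx)

theorem pos_of_strictMonoOn_Ioc_of_tendsto_zero {b : ℝ → ℝ} {T : ℝ}
    (hb : StrictMonoOn b (Ioc 0 T)) (hb0 : Tendsto b (nhdsWithin 0 (Ioi 0)) (nhds 0))
    {t : ℝ} (ht : t ∈ Ioc 0 T) : 0 < b t := by
  have hh : t / 2 ∈ Ioc 0 T := ⟨by linarith [ht.1], by linarith [ht.1, ht.2]⟩
  have h0 : 0 ≤ b (t / 2) := by
    refine le_of_tendsto hb0 ?_
    filter_upwards [Ioo_mem_nhdsGT hh.1] with x hx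
    exact (hb ⟨hx.1, hx.2.le.trans hh.2⟩ hh hx.2).le
  exact h0.trans_lt (hb hh ht (half_lt_self ht.1))

theorem integral_mul_exp_le_of_monotoneOn {b : ℝ → ℝ} {k T t : ℝ} (hk : 0 < k)
    (hb : MonotoneOn b (Ioc 0 T))
    (hi : IntegrableOn (fun s => b s * Real.exp (2 * k * s)) (Ioc 0 T)) (ht : t ∈ Ioc 0 T) :
    2 * k * ∫ s in (0:ℝ)..t, b s * Real.exp (2 * k * s) ≤ b t * (Real.exp (2 * k * t) - 1) := by
  have hle : ∫ s in (0:ℝ)..t, b s * Real.exp (2 * k * s)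
      ≤ ∫ s in (0:ℝ)..t, b t * Real.exp (2 * k * s) := by
    refine intervalIntegral.integral_mono_on_of_le_Ioo ht.1.le
      ((intervalIntegrable_iff_integrableOn_Ioc_of_le ht.1.le).2
        (hi.mono_set (Ioc_subset_Ioc_right ht.2)))
      (Continuous.intervalIntegrable (by fun_prop) _ _) fun x hx => ?_
    gcongr
    exact hb ⟨hx.1, hx.2.le.trans ht.2⟩ ht hx.2.le
  have hexp : ∫ s in (0:ℝ)..t, b t * Real.exp (2 * k * s)
      = b t * ((2 * k)⁻¹ * (Real.exp (2 * k * t) - 1)) := by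
    rw [intervalIntegral.integral_const_mul,
      intervalIntegral.integral_comp_mul_left (fun x => Real.exp x) (by positivity)]
    simp
  rw [hexp] at hle
  calc _ ≤ 2 * k * (b t * ((2 * k)⁻¹ * (Real.exp (2 * k * t) - 1))) := by gcongr
    _ = _ := by field_simp

/-- With `b ∈ C¹((0,T])`, `b(0⁺)=0`, `b' > 0`, `b'²/b ∈ L¹`, and
`β(t) = 1 - (2k/(b(t)e^{2kt})) ∫₀ᵗ b(s)e^{2ks} ds`,
the function `ψ(t) = (n/(8b(t))) ∫₀ᵗ b'(s)²/(b(s)β(s)) ds` solves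
`ψ' + ((2kβ+β')/(1-β)) ψ - n(2kβ+β')²/(8β(1-β)²) = 0` on `(0,T]`. -/
theorem psi_solves_ode (k T n : ℝ) (hk : 0 < k) (hT : 0 < T) (hn : 0 < n) (b β ψ : ℝ → ℝ)
    (hb_diff : ∀ t ∈ Ioc (0:ℝ) T, DifferentiableWithinAt ℝ b (Ioc (0:ℝ) T) t)
    (hb_cont : ContinuousOn (derivWithin b (Ioc (0:ℝ) T)) (Ioc (0:ℝ) T))
    (hb'_pos : ∀ t ∈ Ioc (0:ℝ) T, 0 < derivWithin b (Ioc (0:ℝ) T) t)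
    (hb0 : Tendsto b (nhdsWithin 0 (Ioi 0)) (nhds 0))
    (hbL1 : IntegrableOn (fun t => (derivWithin b (Ioc (0:ℝ) T) t) ^ 2 / b t) (Ioc (0:ℝ) T))
    (hβ : ∀ t, β t = 1 - (2 * k / (b t * Real.exp (2 * k * t))) *
      ∫ s in (0:ℝ)..t, b s * Real.exp (2 * k * s))
    (hψ : ∀ t, ψ t = (n / (8 * b t)) *
      ∫ s in (0:ℝ)..t, (derivWithin b (Ioc (0:ℝ) T) s) ^ 2 / (b s * β s)) :
    ∀ t ∈ Ioc (0:ℝ) T,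
      derivWithin ψ (Ioc (0:ℝ) T) t
        + ((2 * k * β t + derivWithin β (Ioc (0:ℝ) T) t) / (1 - β t)) * ψ t
        - n * (2 * k * β t + derivWithin β (Ioc (0:ℝ) T) t) ^ 2
            / (8 * β t * (1 - β t) ^ 2) = 0 := by
  set S := Ioc (0:ℝ) T with hS
  set b' := derivWithin b S with hb'
  set F : ℝ → ℝ := fun s => b s * Real.exp (2 * k * s) with hF
  set I : ℝ → ℝ := fun t => ∫ s in (0:ℝ)..t, F s with hI
  have hbc : ContinuousOn b S := fun t ht => (hb_diff t ht).continuousWithinAt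
  have hbm : StrictMonoOn b S := strictMonoOn_Ioc_of_derivWithin_pos hbc hb'_pos
  have hbpos : ∀ t ∈ S, 0 < b t := fun t ht =>
    pos_of_strictMonoOn_Ioc_of_tendsto_zero hbm hb0 ht
  have hFc : ContinuousOn F S := hbc.mul (by fun_prop)
  have hFi : IntegrableOn F S := by
    refine IntegrableOn.of_bound measure_Ioc_lt_top
      (hFc.aestronglyMeasurable measurableSet_Ioc) (b T * Real.exp (2 * k * T)) ?_
    refine (ae_restrict_iff' measurableSet_Ioc).2 (ae_of_all _ fun s hs => ?_)
    have hsb := hbpos s hs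
    have hTS : T ∈ S := ⟨hT, le_rfl⟩
    rw [Real.norm_of_nonneg (by positivity)]
    exact mul_le_mul (hbm.monotoneOn hs hTS hs.2)
      (Real.exp_le_exp.2 (by have := hs.2; gcongr)) (Real.exp_pos _).le (hbpos T hTS).le
  have hIpos : ∀ t ∈ S, 0 < I t := fun t ht =>
    intervalIntegral.intervalIntegral_pos_of_pos_on
      ((intervalIntegrable_iff_integrableOn_Ioc_of_le ht.1.le).2
        (hFi.mono_set (Ioc_subset_Ioc_right ht.2)))
      (fun x hx => mul_pos (hbpos x ⟨hx.1, hx.2.le.trans ht.2⟩) (Real.exp_pos _)) ht.1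
  have hIder : ∀ t ∈ S, HasDerivWithinAt I (F t) S t := fun t ht =>
    hasDerivWithinAt_integral_of_continuousOn_Ioc hFc hFi ht
  have hbder : ∀ t ∈ S, HasDerivWithinAt b (b' t) S t := fun t ht =>
    (hb_diff t ht).hasDerivWithinAt
  have hβF : ∀ t, β t = 1 - 2 * k / F t * I t := hβ
  have hFpos : ∀ t ∈ S, 0 < F t := fun t ht => mul_pos (hbpos t ht) (Real.exp_pos _)
  have hβlow : ∀ t ∈ S, Real.exp (-(2 * k * T)) ≤ β t := by
    intro t ht
    have hle : 2 * k * I t ≤ b t * (Real.exp (2 * k * t) - 1) :=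
      integral_mul_exp_le_of_monotoneOn hk hbm.monotoneOn hFi ht
    have hexp : Real.exp (-(2 * k * T)) ≤ Real.exp (-(2 * k * t)) :=
      Real.exp_le_exp.2 (by nlinarith [ht.2])
    have hFt : F t * Real.exp (-(2 * k * t)) = b t := by
      simp only [hF]
      rw [mul_assoc, ← Real.exp_add]
      simp
    refine hexp.trans ?_
    rw [hβF, le_sub_comm, div_mul_eq_mul_div, div_le_iff₀ (hFpos t ht)]
    calc 2 * k * I t ≤ F t - b t := hle.trans_eq (by simp only [hF]; ring)
      _ = (1 - Real.exp (-(2 * k * t))) * F t := by rw [← hFt]; ring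
  have hβpos : ∀ t ∈ S, 0 < β t := fun t ht => (Real.exp_pos _).trans_le (hβlow t ht)
  have hβder : ∀ t ∈ S,
      HasDerivWithinAt β ((1 - β t) * (b' t / b t) - 2 * k * β t) S t := by
    intro t ht
    have hexpd : HasDerivWithinAt (fun s => Real.exp (2 * k * s))
        (Real.exp (2 * k * t) * (2 * k)) S t := by
      simpa using (((hasDerivAt_id t).const_mul (2 * k)).exp).hasDerivWithinAt
    have hFd : HasDerivWithinAt F _ S t := (hbder t ht).mul hexpd
    have hd := (((hIder t ht).const_mul (2 * k)).div hFd (hFpos t ht).ne').const_sub 1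
    have hfun : β = fun t => 1 - 2 * k * I t / F t := by
      funext s
      rw [hβF, div_mul_eq_mul_div]
    have hb0 := (hbpos t ht).ne'
    have he0 := (Real.exp_pos (2 * k * t)).ne'
    have hFt : F t = b t * Real.exp (2 * k * t) := rfl
    rw [hfun]
    refine hd.congr_deriv ?_
    simp only [hFt]
    field_simp
    ring
  have hβc : ContinuousOn β S := fun t ht => (hβder t ht).continuousWithinAt
  set G : ℝ → ℝ := fun s => b' s ^ 2 / (b s * β s) with hG
  have hGc : ContinuousOn G S := (hb_cont.pow 2).div (hbc.mul hβc) fun t ht =>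
    (mul_pos (hbpos t ht) (hβpos t ht)).ne'
  have hGi : IntegrableOn G S := by
    refine Integrable.mono' (hbL1.const_mul (Real.exp (2 * k * T)))
      (hGc.aestronglyMeasurable measurableSet_Ioc) ?_
    refine (ae_restrict_iff' measurableSet_Ioc).2 (ae_of_all _ fun s hs => ?_)
    have hsb := hbpos s hs
    have hsβ := hβpos s hs
    rw [Real.norm_of_nonneg (by positivity)]
    have hinv : (β s)⁻¹ ≤ Real.exp (2 * k * T) := by
      rw [← inv_inv (Real.exp (2 * k * T)), ← Real.exp_neg]
      exact inv_anti₀ (Real.exp_pos _) (hβlow s hs)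
    calc b' s ^ 2 / (b s * β s) = (β s)⁻¹ * (b' s ^ 2 / b s) := by field_simp
      _ ≤ _ := by gcongr
  intro t ht
  have hbt := hbpos t ht
  have hβt := hβpos t ht
  have huniq : UniqueDiffWithinAt ℝ S t := uniqueDiffOn_Ioc 0 T t ht
  have h1β : 1 - β t ≠ 0 := by
    have := hIpos t ht
    have := hFpos t ht
    rw [hβF, sub_sub_cancel]
    positivity
  have hψder : HasDerivWithinAt ψ (n / (8 * b t) * G t - b' t / b t * ψ t) S t := by
    have hGd : HasDerivWithinAt (fun u => ∫ s in (0:ℝ)..u, G s) (G t) S t :=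
      hasDerivWithinAt_integral_of_continuousOn_Ioc hGc hGi ht
    have hd := ((hasDerivWithinAt_const t S n).div ((hbder t ht).const_mul 8)
      (by positivity)).mul hGd
    have hfun : ψ = fun t => n / (8 * b t) * ∫ s in (0:ℝ)..t, G s := funext hψ
    rw [hfun]
    refine hd.congr_deriv ?_
    simp only [Pi.div_apply]
    field_simp
    ring
  rw [hψder.derivWithin huniq, (hβder t ht).derivWithin huniq, add_sub_cancel]
  simp only [hG]
  field_simp
  ring
end

section
/- Let $k>0$, $\theta\in(0,1)$, $T>0$, and set $b(t)=(1+\theta kt)\,t^{\frac{2}{\theta}-1}$ for $t\in(0,T]$. Then (C3): there exists $\delta\in(0,1)$ such that $t\mapsto \frac{b'(t)}{b(t)^{\delta}}$ is bounded from above on $(0,T]$, and (C4): $t\mapsto \frac{b'(t)\int_0^t b(s)\,ds}{b(t)^2}$ is bounded from above on $(0,T]$. -/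
open Real Set Filter MeasureTheory

lemma hasDerivAt_affine_mul_rpow (c p : ℝ) {t : ℝ} (ht : 0 < t) :
    HasDerivAt (fun t : ℝ => (1 + c * t) * t ^ p)
      (c * t ^ p + (1 + c * t) * (p * t ^ (p - 1))) t := by
  have h₁ : HasDerivAt (fun t : ℝ => 1 + c * t) c t := by
    simpa using ((hasDerivAt_id t).const_mul c).const_add 1
  exact h₁.mul (Real.hasDerivAt_rpow_const (Or.inl ht.ne'))

lemma deriv_affine_mul_rpow_le {c t : ℝ} (p : ℝ) (ht : 0 < t) :
    deriv (fun t : ℝ => (1 + c * t) * t ^ p) t ≤ (p + 1) * (1 + c * t) * t ^ (p - 1) := by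
  rw [(hasDerivAt_affine_mul_rpow c p ht).deriv]
  have h : t ^ p = t * t ^ (p - 1) := by
    rw [Real.rpow_sub_one ht.ne']
    field_simp
  rw [h]
  nlinarith [Real.rpow_pos_of_pos ht (p - 1)]

lemma integral_affine_mul_rpow_le {c p t : ℝ} (hc : 0 ≤ c) (hp : 0 ≤ p) (ht : 0 ≤ t) :
    ∫ s in (0:ℝ)..t, (1 + c * s) * s ^ p ≤ (1 + c * t) * t ^ p * t := by
  have h : ‖∫ s in (0:ℝ)..t, (1 + c * s) * s ^ p‖ ≤ (1 + c * t) * t ^ p * |t - 0| := by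
    refine intervalIntegral.norm_integral_le_of_norm_le_const fun s hs => ?_
    rw [uIoc_of_le ht] at hs
    have hs₀ : 0 ≤ s := hs.1.le
    have hst : s ≤ t := hs.2
    rw [Real.norm_of_nonneg (by positivity)]
    gcongr
  rw [sub_zero, abs_of_nonneg ht] at h
  exact (le_abs_self _).trans h

/-- For `b(t) = (1+θkt) t^{2/θ-1}` with `θ ∈ (0,1)`, `b` satisfies
(C3): there is `δ ∈ (0,1)` such that `b'/b^δ` is bounded from above on `(0,T]`, and
(C4): `b' ∫₀ᵗ b / b²` is bounded from above on `(0,T]`. -/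
theorem power_b_satisfies_C3_C4 (k θ T : ℝ) (hk : 0 < k) (hθ : θ ∈ Ioo (0:ℝ) 1) (hT : 0 < T)
    (b : ℝ → ℝ) (hb : ∀ t, b t = (1 + θ * k * t) * t ^ (2 / θ - 1)) :
    (∃ δ ∈ Ioo (0:ℝ) 1, ∃ C : ℝ, ∀ t ∈ Ioc (0:ℝ) T, deriv b t / b t ^ δ ≤ C) ∧
    (∃ C : ℝ, ∀ t ∈ Ioc (0:ℝ) T,
      deriv b t * (∫ s in (0:ℝ)..t, b s) / (b t) ^ 2 ≤ C) := by
  obtain ⟨hθ₀, hθ₁⟩ := hθ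
  set p := 2 / θ - 1 with hp_def
  set c := θ * k with hc_def
  have hc : 0 < c := mul_pos hθ₀ hk
  have hp : 1 < p := by
    have : 2 < 2 / θ := by rw [lt_div_iff₀ hθ₀]; linarith
    linarith
  obtain rfl : b = fun t => (1 + c * t) * t ^ p := funext hb
  refine ⟨⟨1 - 1 / p, ⟨?_, ?_⟩, (p + 1) * (1 + c * T), ?_⟩, p + 1, ?_⟩
  · rw [sub_pos, div_lt_one (by linarith)]
    exact hp
  · have : 0 < 1 / p := by positivity
    linarith
  · rintro t ⟨ht, htT⟩
    have hδ : 0 ≤ 1 - 1 / p := by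
      rw [sub_nonneg, div_le_one (by linarith)]
      exact hp.le
    have hpow : t ^ (p - 1) ≤ ((1 + c * t) * t ^ p) ^ (1 - 1 / p) := by
      have heq : t ^ (p - 1) = (t ^ p) ^ (1 - 1 / p) := by
        rw [← Real.rpow_mul ht.le]
        congr 1
        field_simp
      rw [heq]
      gcongr
      exact le_mul_of_one_le_left (by positivity) (by linarith [mul_pos hc ht])
    rw [div_le_iff₀ (by positivity)]
    refine (deriv_affine_mul_rpow_le p ht).trans ?_
    gcongr
  · rintro t ⟨ht, -⟩
    rw [div_le_iff₀ (by positivity)]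
    have hI : 0 ≤ ∫ s in (0:ℝ)..t, (1 + c * s) * s ^ p :=
      intervalIntegral.integral_nonneg ht.le fun s hs => by
        have := hs.1
        positivity
    calc _ ≤ (p + 1) * (1 + c * t) * t ^ (p - 1) * ((1 + c * t) * t ^ p * t) :=
          mul_le_mul (deriv_affine_mul_rpow_le p ht)
            (integral_affine_mul_rpow_le hc.le (by linarith) ht.le) hI (by positivity)
      _ = (p + 1) * ((1 + c * t) * t ^ p) ^ 2 := by
          rw [Real.rpow_sub_one ht.ne']
          field_simp
end
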